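/- arXiv:1207.5285 — 2 statements merged into one kernel-verified Lean document; each statement's English description precedes it below -/
import Mathlib

section
/- Let n ≥ 2 and let (u,v) be a solution of Δu = u v², Δv = v u², u > 0, v > 0 on ℝⁿ. Then for every x ∈ ℝⁿ the function D(r; x) := r^{2−n} ∫_{B_r(x)} (|∇u|² + |∇v|² + u²v²) is nondecreasing in r > 0. -/
open MeasureTheory Metric
open scoped RealInnerProductSpace

noncomputable section

/-- The Laplacian of a function on Euclidean space, as the trace of the second derivative. -/
def lap {n : ℕ} (u : EuclideanSpace ℝ (Fin n) → ℝ) (x : EuclideanSpace ℝ (Fin n)) : ℝ :=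
  ∑ i : Fin n, iteratedFDeriv ℝ 2 u x (fun _ => EuclideanSpace.single i 1)

/-- A (positive classical) solution of the system Δu = u v², Δv = v u², u,v > 0 on ℝⁿ. -/
def IsSolution {n : ℕ} (u v : EuclideanSpace ℝ (Fin n) → ℝ) : Prop :=
  ContDiff ℝ (⊤ : ℕ∞) u ∧ ContDiff ℝ (⊤ : ℕ∞) v ∧ (∀ x, 0 < u x) ∧ (∀ x, 0 < v x) ∧
    (∀ x, lap u x = u x * v x ^ 2) ∧ (∀ x, lap v x = v x * u x ^ 2)

/-- The bulk energy ∫_{B_r(x)} (|∇u|² + |∇v|² + u²v²). -/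
def bulk {n : ℕ} (u v : EuclideanSpace ℝ (Fin n) → ℝ) (x : EuclideanSpace ℝ (Fin n)) (r : ℝ) :
    ℝ :=
  ∫ y in ball x r, (‖gradient u y‖ ^ 2 + ‖gradient v y‖ ^ 2 + (u y) ^ 2 * (v y) ^ 2)

/-- The boundary mass ∫_{∂B_r(x)} (u² + v²), w.r.t. the (n-1)-dimensional surface
(Hausdorff) measure on the sphere. -/
def bdry {n : ℕ} (u v : EuclideanSpace ℝ (Fin n) → ℝ) (x : EuclideanSpace ℝ (Fin n)) (r : ℝ) :
    ℝ :=
  ∫ y in sphere x r, ((u y) ^ 2 + (v y) ^ 2) ∂μH[(n : ℝ) - 1]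

/-- The Almgren frequency N(r; x). -/
def freq {n : ℕ} (u v : EuclideanSpace ℝ (Fin n) → ℝ) (x : EuclideanSpace ℝ (Fin n)) (r : ℝ) :
    ℝ :=
  r * bulk u v x r / bdry u v x r

section Divergence

variable {E : Type*} [NormedAddCommGroup E] [InnerProductSpace ℝ E]

/-- A smooth radial cutoff, nonincreasing in `‖y - x‖`, supported in the closed ball of radius `r`;
as `k → ∞` it converges to the indicator function of the open ball. -/
def radialCutoff (x : E) (r k : ℝ) (y : E) : ℝ :=
  Real.smoothTransition (k * (r ^ 2 - ‖y - x‖ ^ 2))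

lemma contDiff_radialCutoff (x : E) (r k : ℝ) : ContDiff ℝ 1 (radialCutoff x r k) := by
  have h : ContDiff ℝ 1 fun y : E => k * (r ^ 2 - ‖y - x‖ ^ 2) :=
    contDiff_const.mul (contDiff_const.sub ((contDiff_id.sub contDiff_const).norm_sq ℝ))
  exact (Real.smoothTransition.contDiff (n := 1)).comp h

lemma exists_fderiv_radialCutoff_eq (x : E) (r : ℝ) {k : ℝ} (hk : 0 ≤ k) (y : E) :
    ∃ c : ℝ, c ≤ 0 ∧ ∀ w, fderiv ℝ (radialCutoff x r k) y w = c * ⟪y - x, w⟫ := by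
  have h1 : HasFDerivAt (fun y : E => ‖y - x‖ ^ 2) (2 • (innerSL ℝ (y - x))) y := by
    simpa using ((hasFDerivAt_id y).sub_const x).norm_sq
  have h2 := ((h1.const_sub (r ^ 2)).const_mul k)
  have h3 : HasDerivAt Real.smoothTransition
      (deriv Real.smoothTransition (k * (r ^ 2 - ‖y - x‖ ^ 2))) (k * (r ^ 2 - ‖y - x‖ ^ 2)) :=
    ((Real.smoothTransition.contDiff (n := 1)).differentiable one_ne_zero _).hasDerivAt
  have h4 := h3.comp_hasFDerivAt y h2
  have h5 : 0 ≤ deriv Real.smoothTransition (k * (r ^ 2 - ‖y - x‖ ^ 2)) :=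
    Real.smoothTransition.monotone.deriv_nonneg
  refine ⟨-(deriv Real.smoothTransition (k * (r ^ 2 - ‖y - x‖ ^ 2)) * k * 2), ?_, fun w => ?_⟩
  · have := mul_nonneg (mul_nonneg h5 hk) (zero_le_two (α := ℝ))
    linarith
  · have h6 : fderiv ℝ (radialCutoff x r k) y = _ := h4.fderiv
    rw [h6]
    simp [-map_sub]
    ring

lemma radialCutoff_eq_zero {F : Type*} [NormedAddCommGroup F] {x : F} {r k : ℝ} (hr : 0 < r) (hk : 0 ≤ k)
    {y : F} (hy : y ∉ ball x r) : radialCutoff x r k y = 0 := by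
  rw [mem_ball, dist_eq_norm, not_lt] at hy
  apply Real.smoothTransition.zero_of_nonpos
  exact mul_nonpos_of_nonneg_of_nonpos hk (by nlinarith)

variable [FiniteDimensional ℝ E] [MeasurableSpace E] [BorelSpace E]

/-- If a `C¹` vector field points outwards from `x` everywhere, then the integral of its divergence
over a ball centered at `x` is nonnegative. -/
lemma setIntegral_divergence_nonneg {ι : Type*} [Fintype ι] (b : OrthonormalBasis ι ℝ E)
    {V : E → E} (hV : ContDiff ℝ 1 V) (x : E) (hVx : ∀ y, 0 ≤ ⟪y - x, V y⟫) {r : ℝ}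
    (hr : 0 < r) :
    0 ≤ ∫ y in ball x r, ∑ i, fderiv ℝ (fun z => ⟪b i, V z⟫) y (b i) := by
  have hVi (i : ι) : ContDiff ℝ 1 fun z => ⟪b i, V z⟫ := contDiff_const.inner ℝ hV
  set d : E → ℝ := fun y => ∑ i, fderiv ℝ (fun z => ⟪b i, V z⟫) y (b i) with hd
  have hdi (i : ι) : Continuous fun y => fderiv ℝ (fun z => ⟪b i, V z⟫) y (b i) :=
    ((hVi i).continuous_fderiv one_ne_zero).clm_apply continuous_const
  have hdc : Continuous d := continuous_finsetSum _ fun i _ => hdi i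
  have hsupp {k : ℝ} (hk : 0 ≤ k) : HasCompactSupport (radialCutoff x r k) :=
    HasCompactSupport.intro (isCompact_closedBall x r) fun y hy =>
      radialCutoff_eq_zero hr hk fun h => hy (ball_subset_closedBall h)
  have hpos {k : ℝ} (hk : 0 ≤ k) : 0 ≤ ∫ y in ball x r, radialCutoff x r k y * d y := by
    have hφ := contDiff_radialCutoff x r k
    have hφ' (i : ι) : Continuous fun y => fderiv ℝ (radialCutoff x r k) y (b i) :=
      (hφ.continuous_fderiv one_ne_zero).clm_apply continuous_const
    have hint1 (i : ι) : Integrable fun y =>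
        fderiv ℝ (radialCutoff x r k) y (b i) * ⟪b i, V y⟫ :=
      ((hφ' i).mul (hVi i).continuous).integrable_of_hasCompactSupport
        (((hsupp hk).fderiv_apply ℝ (b i)).mul_right)
    have hint2 (i : ι) : Integrable fun y =>
        radialCutoff x r k y * fderiv ℝ (fun z => ⟪b i, V z⟫) y (b i) :=
      (hφ.continuous.mul (hdi i)).integrable_of_hasCompactSupport (hsupp hk).mul_right
    have hint3 (i : ι) : Integrable fun y => radialCutoff x r k y * ⟪b i, V y⟫ :=
      (hφ.continuous.mul (hVi i).continuous).integrable_of_hasCompactSupport (hsupp hk).mul_right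
    have key : ∫ y, radialCutoff x r k y * d y =
        ∫ y, -∑ i, fderiv ℝ (radialCutoff x r k) y (b i) * ⟪b i, V y⟫ := by
      rw [integral_neg, integral_finsetSum _ fun i _ => hint1 i, ← Finset.sum_neg_distrib]
      simp_rw [hd, Finset.mul_sum]
      rw [integral_finsetSum _ fun i _ => hint2 i]
      refine Finset.sum_congr rfl fun i _ => ?_
      exact integral_mul_fderiv_eq_neg_fderiv_mul_of_integrable (hint1 i) (hint2 i) (hint3 i)
        (fun y _ => hφ.differentiable one_ne_zero y)
        (fun y _ => (hVi i).differentiable one_ne_zero y)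
    rw [setIntegral_eq_integral_of_forall_compl_eq_zero, key]
    · refine integral_nonneg fun y => ?_
      obtain ⟨c, hc, hcw⟩ := exists_fderiv_radialCutoff_eq x r hk y
      simp only [hcw, mul_assoc, ← Finset.mul_sum, b.sum_inner_mul_inner, Pi.zero_apply]
      have := mul_nonneg (neg_nonneg.2 hc) (hVx y)
      linarith
    · intro y hy
      rw [radialCutoff_eq_zero hr hk hy, zero_mul]
  have hlim : Filter.Tendsto (fun k : ℕ => ∫ y in ball x r, radialCutoff x r k y * d y)
      Filter.atTop (nhds (∫ y in ball x r, d y)) := by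
    refine tendsto_integral_of_dominated_convergence (fun y => ‖d y‖) (fun k => ?_) ?_
      (fun k => ?_) ?_
    · exact ((contDiff_radialCutoff x r k).continuous.mul hdc).aestronglyMeasurable
    · exact ((hdc.norm.continuousOn.integrableOn_compact
        (isCompact_closedBall x r)).mono_set ball_subset_closedBall)
    · refine Filter.Eventually.of_forall fun y => ?_
      rw [norm_mul]
      refine mul_le_of_le_one_left (norm_nonneg _) ?_
      rw [radialCutoff, Real.norm_of_nonneg (Real.smoothTransition.nonneg _)]
      exact Real.smoothTransition.le_one _
    · refine (ae_restrict_iff' measurableSet_ball).2 (Filter.Eventually.of_forall fun y hy => ?_)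
      rw [mem_ball, dist_eq_norm] at hy
      have h0 : 0 < r ^ 2 - ‖y - x‖ ^ 2 := by nlinarith [norm_nonneg (y - x)]
      have h1 : ∀ᶠ k : ℕ in Filter.atTop, 1 ≤ (k : ℝ) * (r ^ 2 - ‖y - x‖ ^ 2) :=
        (tendsto_natCast_atTop_atTop.atTop_mul_const h0).eventually_ge_atTop 1
      refine tendsto_const_nhds.congr' ?_
      filter_upwards [h1] with k hk
      rw [radialCutoff, Real.smoothTransition.one_of_one_le hk, one_mul]
  exact ge_of_tendsto' hlim fun k => hpos k.cast_nonneg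

end Divergence

section Pohozaev

variable {E : Type*} [NormedAddCommGroup E] [InnerProductSpace ℝ E] [CompleteSpace E]

lemma ContDiff.gradient_infty {u : E → ℝ} (hu : ContDiff ℝ (⊤ : ℕ∞) u) :
    ContDiff ℝ (⊤ : ℕ∞) (gradient u) :=
  (InnerProductSpace.toDual ℝ E).symm.contDiff.comp (hu.fderiv_right le_rfl)

/-- The Pohozaev vector field `((y - x) · ∇u) ∇u`. -/
def pohozaevField (u : E → ℝ) (x y : E) : E := ⟪y - x, gradient u y⟫ • gradient u y

lemma contDiff_pohozaevField {u : E → ℝ} (hu : ContDiff ℝ (⊤ : ℕ∞) u) (x : E) :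
    ContDiff ℝ (⊤ : ℕ∞) (pohozaevField u x) :=
  ((contDiff_id.sub contDiff_const).inner ℝ hu.gradient_infty).smul hu.gradient_infty

lemma inner_pohozaevField_nonneg (u : E → ℝ) (x y : E) :
    0 ≤ ⟪y - x, pohozaevField u x y⟫ := by
  rw [pohozaevField, real_inner_smul_right]
  exact mul_self_nonneg _

lemma inner_fderiv_gradient {u : E → ℝ} (hu : ContDiff ℝ (⊤ : ℕ∞) u) (y w z : E) :
    ⟪fderiv ℝ (gradient u) y w, z⟫ = fderiv ℝ (fderiv ℝ u) y w z := by
  have hg : HasFDerivAt (gradient u) (fderiv ℝ (gradient u) y) y :=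
    (hu.gradient_infty.differentiable (by simp) y).hasFDerivAt
  have h : HasFDerivAt (fderiv ℝ u) (fderiv ℝ (fderiv ℝ u) y) y :=
    ((hu.fderiv_right (m := (⊤ : ℕ∞)) le_rfl).differentiable (by simp) y).hasFDerivAt
  have h1 := hg.inner ℝ (hasFDerivAt_const z y)
  have h2 := h.clm_apply (hasFDerivAt_const z y)
  simp_rw [inner_gradient_left] at h1
  simpa using congrArg (fun L => L w) (h1.unique h2)

lemma two_mul_divergence_pohozaevField {ι : Type*} [Fintype ι] (b : OrthonormalBasis ι ℝ E)
    {u : E → ℝ} (hu : ContDiff ℝ (⊤ : ℕ∞) u) (x y : E) :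
    2 * ∑ i, fderiv ℝ (fun z => ⟪b i, pohozaevField u x z⟫) y (b i) =
      fderiv ℝ (fun z => ‖gradient u z‖ ^ 2) y (y - x) + 2 * ‖gradient u y‖ ^ 2 +
        2 * fderiv ℝ u y (y - x) * ∑ i, fderiv ℝ (fderiv ℝ u) y (b i) (b i) := by
  have hg : HasFDerivAt (gradient u) (fderiv ℝ (gradient u) y) y :=
    (hu.gradient_infty.differentiable (by simp) y).hasFDerivAt
  have hsymm : IsSymmSndFDerivAt ℝ u y := hu.contDiffAt.isSymmSndFDerivAt (by
    rw [minSmoothness_of_isRCLikeNormedField]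
    exact WithTop.coe_le_coe.2 le_top)
  have hf := ((hasFDerivAt_id y).sub_const x).inner ℝ hg
  have hterm (i : ι) : fderiv ℝ (fun z => ⟪b i, pohozaevField u x z⟫) y (b i) =
      ⟪gradient u y, b i⟫ * ⟪b i, gradient u y⟫ +
      ⟪fderiv ℝ (gradient u) y (y - x), b i⟫ * ⟪b i, gradient u y⟫ +
      fderiv ℝ u y (y - x) * fderiv ℝ (fderiv ℝ u) y (b i) (b i) := by
    have h := (hasFDerivAt_const (b i) y).inner ℝ (hf.smul hg)
    have h' : fderiv ℝ (fun z => ⟪b i, pohozaevField u x z⟫) y = _ := h.fderiv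
    rw [h', inner_fderiv_gradient hu, hsymm, ← inner_fderiv_gradient hu,
      ← inner_fderiv_gradient hu, ← inner_gradient_left]
    simp [inner_add_right, real_inner_smul_right, real_inner_comm]
    ring
  simp_rw [hterm, Finset.sum_add_distrib, ← Finset.mul_sum, b.sum_inner_mul_inner]
  rw [hg.norm_sq.fderiv]
  simp
  ring

end Pohozaev

section Scaling

lemma setIntegral_ball_comp_add_smul {n : ℕ} (f : EuclideanSpace ℝ (Fin n) → ℝ)
    (x : EuclideanSpace ℝ (Fin n)) {r : ℝ} (hr : 0 < r) :
    ∫ z in ball 0 1, f (x + r • z) = (r ^ n)⁻¹ * ∫ y in ball x r, f y := by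
  have h := Measure.setIntegral_comp_smul_of_pos volume (fun z => f (x + z)) (ball 0 1) hr
  rw [h, finrank_euclideanSpace_fin, smul_eq_mul, smul_unitBall_of_pos hr]
  congr 1
  have h2 := (measurePreserving_add_left volume x).setIntegral_preimage_emb
    (measurableEmbedding_addLeft x) f (ball x r)
  rw [← h2]
  simp

lemma monotoneOn_rpow_mul_setIntegral_ball {n : ℕ} {e : EuclideanSpace ℝ (Fin n) → ℝ}
    (he : ContDiff ℝ 1 e) (x : EuclideanSpace ℝ (Fin n))
    (hpos : ∀ r, 0 < r → 0 ≤ ∫ y in ball x r, (2 * e y + fderiv ℝ e y (y - x))) :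
    MonotoneOn (fun r : ℝ => r ^ ((2 : ℝ) - n) * ∫ y in ball x r, e y) (Set.Ioi 0) := by
  have hbdd {f : EuclideanSpace ℝ (Fin n) → ℝ} (hf : Continuous f) :
      IntegrableOn f (ball 0 1) :=
    (hf.continuousOn.integrableOn_compact (isCompact_closedBall 0 1)).mono_set
      ball_subset_closedBall
  have he' := he.continuous_fderiv one_ne_zero
  have hderiv (r : ℝ) : HasDerivAt (fun r : ℝ => ∫ z in ball 0 1, e (x + r • z))
      (∫ z in ball 0 1, fderiv ℝ e (x + r • z) z) r := by
    have hc : Continuous fun p : ℝ × EuclideanSpace ℝ (Fin n) =>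
        fderiv ℝ e (x + p.1 • p.2) p.2 := by fun_prop
    obtain ⟨C, hC⟩ := ((isCompact_closedBall (r : ℝ) 1).prod
      (isCompact_closedBall (0 : EuclideanSpace ℝ (Fin n)) 1)).exists_bound_of_continuousOn
        hc.continuousOn
    refine (hasDerivAt_integral_of_dominated_loc_of_deriv_le (𝕜 := ℝ) (bound := fun _ => C)
      (F := fun s z => e (x + s • z)) (F' := fun s z => fderiv ℝ e (x + s • z) z)
      (closedBall_mem_nhds r one_pos)
      (Filter.Eventually.of_forall fun s => ?_) ?_ ?_ ?_ ?_ ?_).2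
    · exact (he.continuous.comp (by fun_prop)).aestronglyMeasurable
    · exact hbdd (he.continuous.comp (by fun_prop))
    · exact (hc.comp (Continuous.prodMk_right r)).aestronglyMeasurable
    · refine (ae_restrict_iff' measurableSet_ball).2 (Filter.Eventually.of_forall ?_)
      exact fun z hz s hs => hC (s, z) ⟨hs, ball_subset_closedBall hz⟩
    · exact hbdd continuous_const
    · refine Filter.Eventually.of_forall fun z s _ => ?_
      have h1 : HasDerivAt (fun s : ℝ => x + s • z) z s := by
        simpa using ((hasDerivAt_id s).smul_const z).const_add x
      exact (he.differentiable one_ne_zero _).hasFDerivAt.comp_hasDerivAt s h1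
  have hderiv2 (r : ℝ) := (hasDerivAt_pow 2 r).mul (hderiv r)
  have hmono : MonotoneOn (fun r : ℝ => r ^ 2 * ∫ z in ball 0 1, e (x + r • z)) (Set.Ioi 0) := by
    refine monotoneOn_of_deriv_nonneg (convex_Ioi 0)
      (fun r _ => (hderiv2 r).continuousAt.continuousWithinAt)
      (fun r _ => (hderiv2 r).differentiableAt.differentiableWithinAt) fun r hr => ?_
    rw [interior_Ioi] at hr
    have hr0 : 0 < r := hr
    have hsum := setIntegral_ball_comp_add_smul (fun y => 2 * e y + fderiv ℝ e y (y - x)) x hr0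
    simp only [add_sub_cancel_left, map_smul, smul_eq_mul] at hsum
    rw [integral_add (hbdd (by have := he.continuous; fun_prop)) (hbdd (by fun_prop)),
      integral_const_mul, integral_const_mul] at hsum
    have h0 := mul_nonneg hr0.le (mul_nonneg (inv_nonneg.2 (pow_nonneg hr0.le n)) (hpos r hr0))
    rw [← hsum] at h0
    have hd : deriv (fun r : ℝ => r ^ 2 * ∫ z in ball 0 1, e (x + r • z)) r = _ :=
      (hderiv2 r).deriv
    rw [hd]
    refine h0.trans_eq ?_
    push_cast
    ring
  refine hmono.congr fun r hr => ?_
  have hr0 : 0 < r := hr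
  simp only
  rw [setIntegral_ball_comp_add_smul e x hr0, Real.rpow_sub hr0, Real.rpow_natCast,
    Real.rpow_two]
  ring

end Scaling

/-- D(r; x) = r^{2-n} ∫_{B_r(x)} (|∇u|² + |∇v|² + u²v²) is nondecreasing in r > 0. -/
theorem D_monotone {n : ℕ} (hn : 2 ≤ n)
    (u v : EuclideanSpace ℝ (Fin n) → ℝ) (hsol : IsSolution u v)
    (x : EuclideanSpace ℝ (Fin n)) :
    MonotoneOn (fun r : ℝ => r ^ ((2 : ℝ) - n) * bulk u v x r) (Set.Ioi 0) := by
  obtain ⟨hu, hv, -, -, hlu, hlv⟩ := hsol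
  have hlap (w : EuclideanSpace ℝ (Fin n) → ℝ) (y : EuclideanSpace ℝ (Fin n)) :
      ∑ i, fderiv ℝ (fderiv ℝ w) y (EuclideanSpace.basisFun (Fin n) ℝ i)
        (EuclideanSpace.basisFun (Fin n) ℝ i) = lap w y := by
    simp [lap, iteratedFDeriv_two_apply]
  have hgu : ContDiff ℝ (⊤ : ℕ∞) fun y => ‖gradient u y‖ ^ 2 := hu.gradient_infty.norm_sq ℝ
  have hgv : ContDiff ℝ (⊤ : ℕ∞) fun y => ‖gradient v y‖ ^ 2 := hv.gradient_infty.norm_sq ℝ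
  have huv : ContDiff ℝ (⊤ : ℕ∞) fun y => u y ^ 2 * v y ^ 2 := (hu.pow 2).mul (hv.pow 2)
  have hone : (1 : WithTop ℕ∞) ≤ ((⊤ : ℕ∞) : WithTop ℕ∞) := by simp
  refine monotoneOn_rpow_mul_setIntegral_ball (((hgu.add hgv).add huv).of_le hone) x
    fun r hr => ?_
  set b := EuclideanSpace.basisFun (Fin n) ℝ
  have hV : ContDiff ℝ 1 fun y => pohozaevField u x y + pohozaevField v x y :=
    ((contDiff_pohozaevField hu x).add (contDiff_pohozaevField hv x)).of_le hone
  have hdiv := setIntegral_divergence_nonneg b hV x (fun y => by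
    rw [inner_add_right]
    exact add_nonneg (inner_pohozaevField_nonneg u x y) (inner_pohozaevField_nonneg v x y)) hr
  have hdivc : Continuous fun y => ∑ i, fderiv ℝ
      (fun z => ⟪b i, pohozaevField u x z + pohozaevField v x z⟫) y (b i) :=
    continuous_finsetSum _ fun i _ => ((contDiff_const.inner ℝ hV).continuous_fderiv
      one_ne_zero).clm_apply continuous_const
  have hint {f : EuclideanSpace ℝ (Fin n) → ℝ} (hf : Continuous f) : IntegrableOn f (ball x r) :=
    (hf.continuousOn.integrableOn_compact (isCompact_closedBall x r)).mono_set
      ball_subset_closedBall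
  have hpt (y : EuclideanSpace ℝ (Fin n)) :
      2 * (‖gradient u y‖ ^ 2 + ‖gradient v y‖ ^ 2 + u y ^ 2 * v y ^ 2) +
        fderiv ℝ (fun y => ‖gradient u y‖ ^ 2 + ‖gradient v y‖ ^ 2 + u y ^ 2 * v y ^ 2) y
          (y - x) =
      2 * ∑ i, fderiv ℝ (fun z => ⟪b i, pohozaevField u x z + pohozaevField v x z⟫) y (b i) +
        2 * (u y ^ 2 * v y ^ 2) := by
    have hsplit (i : Fin n) :
        fderiv ℝ (fun z => ⟪b i, pohozaevField u x z + pohozaevField v x z⟫) y (b i) =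
        fderiv ℝ (fun z => ⟪b i, pohozaevField u x z⟫) y (b i) +
          fderiv ℝ (fun z => ⟪b i, pohozaevField v x z⟫) y (b i) := by
      simp_rw [inner_add_right]
      rw [fderiv_fun_add
        (((contDiff_const.inner ℝ (contDiff_pohozaevField hu x)).differentiable (by simp)) y)
        (((contDiff_const.inner ℝ (contDiff_pohozaevField hv x)).differentiable (by simp)) y)]
      rfl
    simp_rw [hsplit, Finset.sum_add_distrib, mul_add]
    rw [two_mul_divergence_pohozaevField b hu, two_mul_divergence_pohozaevField b hv, hlap, hlap,
      hlu, hlv]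
    have du := (hu.differentiable (by simp) y).hasFDerivAt
    have dv := (hv.differentiable (by simp) y).hasFDerivAt
    have hd := (((hgu.differentiable (by simp) y).hasFDerivAt.add
      (hgv.differentiable (by simp) y).hasFDerivAt).add ((du.pow 2).mul (dv.pow 2))).fderiv
    have hd' : fderiv ℝ (fun y => ‖gradient u y‖ ^ 2 + ‖gradient v y‖ ^ 2 +
      u y ^ 2 * v y ^ 2) y = _ := hd
    rw [hd']
    simp
    ring
  simp_rw [hpt]
  rw [integral_add ((hint hdivc).const_mul 2) (hint (huv.continuous.const_mul 2)),
    integral_const_mul]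
  exact add_nonneg (mul_nonneg zero_le_two hdiv) (integral_nonneg fun y => by positivity)
end
end

section
/- (Almgren monotonicity formula.) Let n ≥ 2 and let (u,v) be a solution of Δu = u v², Δv = v u², u > 0, v > 0 on ℝⁿ. Then for every x ∈ ℝⁿ the function N(r; x) := ( r ∫_{B_r(x)} (|∇u|² + |∇v|² + u²v²) ) / ( ∫_{∂B_r(x)} (u² + v²) ) is nondecreasing in r > 0. -/
open MeasureTheory Metric
open scoped RealInnerProductSpace

noncomputable section

open Set Filter Topology Module

section SphereMean

variable {E : Type*} [NormedAddCommGroup E] [InnerProductSpace ℝ E] [FiniteDimensional ℝ E]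
  [MeasurableSpace E] [BorelSpace E]

/-- The integral of `f` over the sphere of radius `r`, pulled back to the unit sphere. -/
def sphInt (f : E → ℝ) (r : ℝ) : ℝ :=
  ∫ ω : sphere (0 : E) 1, f (r • (ω : E)) ∂(volume : Measure E).toSphere

omit [FiniteDimensional ℝ E] [MeasurableSpace E] [BorelSpace E] in
theorem continuous_smul_sphere {f : E → ℝ} (hf : Continuous f) (r : ℝ) :
    Continuous fun ω : sphere (0 : E) 1 => f (r • (ω : E)) := by
  fun_prop

theorem integrable_sphere {f : sphere (0 : E) 1 → ℝ} (hf : Continuous f)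
    (μ : Measure (sphere (0 : E) 1)) [IsFiniteMeasure μ] : Integrable f μ :=
  hf.integrable_of_hasCompactSupport (HasCompactSupport.of_compactSpace f)

theorem continuous_sphInt {f : E → ℝ} (hf : Continuous f) : Continuous (sphInt f) := by
  have : Continuous (Function.uncurry fun (r : ℝ) (ω : sphere (0 : E) 1) => f (r • (ω : E))) := by
    unfold Function.uncurry
    fun_prop
  have key := continuous_parametric_integral_of_continuous
    (μ := (volume : Measure E).toSphere) this isCompact_univ
  simp only [Measure.restrict_univ] at key
  exact key

theorem hasDerivAt_sphInt {f : E → ℝ} (hf : ContDiff ℝ 1 f) (r : ℝ) :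
    HasDerivAt (sphInt f) (∫ ω : sphere (0 : E) 1, fderiv ℝ f (r • (ω : E)) ω
      ∂(volume : Measure E).toSphere) r := by
  have hfd : Continuous (fderiv ℝ f) := hf.continuous_fderiv (by simp)
  obtain ⟨C, hC⟩ : ∃ C, ∀ y ∈ closedBall (0 : E) (|r| + 1), ‖fderiv ℝ f y‖ ≤ C :=
    (isCompact_closedBall _ _).exists_bound_of_continuousOn hfd.continuousOn
  refine (hasDerivAt_integral_of_dominated_loc_of_deriv_le (bound := fun _ => C)
    (F' := fun t (ω : sphere (0 : E) 1) => fderiv ℝ f (t • (ω : E)) ω)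
    (ball_mem_nhds r one_pos) ?_ ?_ ?_ ?_ (integrable_const _) ?_).2
  · exact .of_forall fun t =>
      (continuous_smul_sphere hf.continuous t).aestronglyMeasurable
  · exact integrable_sphere (continuous_smul_sphere hf.continuous r) _
  · refine Continuous.aestronglyMeasurable ?_
    exact (hfd.comp (by fun_prop)).clm_apply continuous_subtype_val
  · refine .of_forall fun ω t ht => ?_
    have hω : ‖(ω : E)‖ = 1 := by simp
    refine ((fderiv ℝ f (t • (ω : E))).le_opNorm _).trans ?_
    rw [hω, mul_one]
    refine hC _ ?_
    rw [mem_closedBall_zero_iff, norm_smul, hω, mul_one, Real.norm_eq_abs]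
    rw [mem_ball, Real.dist_eq] at ht
    have := abs_sub_abs_le_abs_sub t r
    linarith
  · refine .of_forall fun ω t _ => ?_
    have h1 : HasDerivAt (fun t : ℝ => t • (ω : E)) (ω : E) t := by
      simpa using (hasDerivAt_id t).smul_const (ω : E)
    exact ((hf.differentiable (by simp)) _).hasFDerivAt.comp_hasDerivAt t h1

variable [Nontrivial E]

/-- Integration in polar coordinates. -/
theorem integral_eq_integral_sphInt {f : E → ℝ} (hf : Integrable f) :
    ∫ y, f y = ∫ s in Ioi (0 : ℝ), s ^ (finrank ℝ E - 1) * sphInt f s := by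
  set μ : Measure E := volume
  have hmp := μ.measurePreserving_homeomorphUnitSphereProd
  have hemb := (homeomorphUnitSphereProd E).measurableEmbedding
  set g : sphere (0 : E) 1 × Ioi (0 : ℝ) → ℝ := fun p => f (p.2.1 • p.1.1)
  have hg : ∀ y : ({(0)}ᶜ : Set E), g (homeomorphUnitSphereProd E y) = f y := by
    intro y
    have := homeomorphUnitSphereProd_symm_apply_coe E (homeomorphUnitSphereProd E y)
    rw [Homeomorph.symm_apply_apply] at this
    simp only [g, ← this]
  have hgi : Integrable g (μ.toSphere.prod (.volumeIoiPow (finrank ℝ E - 1))) := by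
    rw [← hmp.integrable_comp_emb hemb]
    have : g ∘ homeomorphUnitSphereProd E = fun y : ({(0)}ᶜ : Set E) => f y := funext hg
    rw [this]
    exact (integrableOn_iff_comap_subtypeVal (measurableSet_singleton _).compl).1 hf.integrableOn
  calc
    ∫ y, f y = ∫ y : ({(0)}ᶜ : Set E), f y ∂(μ.comap (↑)) := by
      rw [integral_subtype_comap (measurableSet_singleton _).compl f, restrict_compl_singleton]
    _ = ∫ p, g p ∂μ.toSphere.prod (.volumeIoiPow (finrank ℝ E - 1)) := by
      rw [← hmp.integral_comp hemb]
      simp only [hg]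
    _ = ∫ s : Ioi (0 : ℝ), sphInt f s ∂.volumeIoiPow (finrank ℝ E - 1) := by
      rw [integral_prod_symm _ hgi]
      rfl
    _ = _ := by
      simp only [Measure.volumeIoiPow, ENNReal.ofReal]
      rw [integral_withDensity_eq_integral_smul,
        integral_subtype_comap measurableSet_Ioi
          fun a ↦ Real.toNNReal (a ^ (finrank ℝ E - 1)) • sphInt f a]
      · refine setIntegral_congr_fun measurableSet_Ioi fun x hx ↦ ?_
        rw [mem_Ioi] at hx
        simp only [NNReal.smul_def, Real.coe_toNNReal _ (pow_nonneg hx.le _), smul_eq_mul]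
      · exact (measurable_subtype_coe.pow_const _).real_toNNReal

theorem setIntegral_ball_eq_integral_sphInt {f : E → ℝ} (hf : Continuous f) {r : ℝ} (hr : 0 ≤ r) :
    ∫ y in ball 0 r, f y = ∫ s in (0 : ℝ)..r, s ^ (finrank ℝ E - 1) * sphInt f s := by
  have hfi : IntegrableOn f (ball 0 r) :=
    (hf.continuousOn.integrableOn_compact (isCompact_closedBall 0 r)).mono_set
      ball_subset_closedBall
  rw [← integral_indicator measurableSet_ball,
    integral_eq_integral_sphInt (hfi.integrable_indicator measurableSet_ball),
    intervalIntegral.integral_of_le hr, integral_Ioc_eq_integral_Ioo,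
    ← Ioi_inter_Iio, ← setIntegral_indicator measurableSet_Iio]
  refine setIntegral_congr_fun measurableSet_Ioi fun s hs ↦ ?_
  rw [mem_Ioi] at hs
  have hmem (ω : sphere (0 : E) 1) : s • (ω : E) ∈ ball (0 : E) r ↔ s < r := by
    simp [norm_smul, abs_of_pos hs]
  by_cases h : s < r
  · simp [sphInt, indicator, hmem, h]
  · simp [sphInt, indicator, hmem, h]

theorem hasDerivAt_setIntegral_ball {f : E → ℝ} (hf : Continuous f) {r : ℝ} (hr : 0 < r) :
    HasDerivAt (fun r => ∫ y in ball 0 r, f y) (r ^ (finrank ℝ E - 1) * sphInt f r) r := by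
  have hc : Continuous fun s => s ^ (finrank ℝ E - 1) * sphInt f s :=
    (continuous_pow _).mul (continuous_sphInt hf)
  refine (intervalIntegral.integral_hasDerivAt_right (hc.intervalIntegrable 0 r)
    hc.stronglyMeasurable.stronglyMeasurableAtFilter hc.continuousAt).congr_of_eventuallyEq ?_
  filter_upwards [lt_mem_nhds hr] with s hs
  exact setIntegral_ball_eq_integral_sphInt hf hs.le

end SphereMean

section Divergence

variable {E : Type*} [NormedAddCommGroup E] [InnerProductSpace ℝ E]

omit [InnerProductSpace ℝ E] in
theorem lipschitzWith_max_sq_sub_norm_sq {r : ℝ} (hr : 0 ≤ r) :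
    LipschitzWith (2 * r).toNNReal fun y : E => max (r ^ 2 - ‖y‖ ^ 2) 0 := by
  refine LipschitzWith.of_le_add_mul _ fun x y => ?_
  rw [Real.coe_toNNReal _ (by positivity)]
  have h1 : ‖y‖ - ‖x‖ ≤ dist x y := by
    rw [dist_comm, dist_eq_norm]
    exact norm_sub_norm_le y x
  have h2 : 2 * r * (‖y‖ - ‖x‖) ≤ 2 * r * dist x y := by gcongr
  have h3 : 0 ≤ 2 * r * dist x y := by positivity
  have hx := norm_nonneg x
  have hy := norm_nonneg y
  refine max_le ?_ (add_nonneg (le_max_right _ _) h3)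
  rcases le_total ‖y‖ ‖x‖ with h | h
  · refine le_add_of_le_of_nonneg (le_max_of_le_left ?_) h3
    gcongr
  · rcases le_total ‖y‖ r with h' | h'
    · have := le_max_left (r ^ 2 - ‖y‖ ^ 2) 0
      nlinarith
    · have := le_max_right (r ^ 2 - ‖y‖ ^ 2) 0
      nlinarith [sq_nonneg (r - ‖x‖)]

variable [FiniteDimensional ℝ E] [MeasurableSpace E] [BorelSpace E]

theorem setIntegral_ball_mul_fderiv {f : E → ℝ} (hf : ContDiff ℝ 1 f) {r : ℝ} (hr : 0 < r)
    (v : E) :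
    ∫ y in ball 0 r, (r ^ 2 - ‖y‖ ^ 2) * fderiv ℝ f y v =
      2 * ∫ y in ball 0 r, inner ℝ y v * f y := by
  let χ : ContDiffBump (0 : E) := ⟨r, r + 1, hr, by linarith⟩
  have hF : ContDiff ℝ 1 fun y => χ y * f y := χ.contDiff.mul hf
  have hFs : HasCompactSupport fun y => χ y * f y := χ.hasCompactSupport.mul_right
  obtain ⟨C, hC⟩ := hF.lipschitzWith_of_hasCompactSupport hFs (by simp)
  have hχ : ∀ y ∈ ball (0 : E) r, χ y = 1 := fun y hy =>
    χ.one_of_mem_closedBall (ball_subset_closedBall hy)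
  have hFf : ∀ y ∈ ball (0 : E) r, (fun y => χ y * f y) =ᶠ[𝓝 y] f := fun y hy => by
    filter_upwards [isOpen_ball.mem_nhds hy] with z hz
    rw [hχ z hz, one_mul]
  have hΦs : HasCompactSupport fun y : E => max (r ^ 2 - ‖y‖ ^ 2) 0 := by
    refine HasCompactSupport.of_support_subset_isCompact (isCompact_closedBall 0 r) fun y hy => ?_
    rw [mem_closedBall_zero_iff]
    by_contra! h
    exact hy (max_eq_right (by nlinarith))
  have key := LipschitzWith.integral_lineDeriv_mul_eq (μ := volume) hC
    (lipschitzWith_max_sq_sub_norm_sq hr.le) hΦs v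
  rw [← integral_const_mul, ← integral_indicator measurableSet_ball,
    ← integral_indicator measurableSet_ball]
  refine Eq.trans (integral_congr_ae (.of_forall fun y => ?_)) (key.trans (integral_congr_ae ?_))
  · by_cases hy : y ∈ ball (0 : E) r
    · have hy' : ‖y‖ < r := by simpa using hy
      have h0 : 0 ≤ r ^ 2 - ‖y‖ ^ 2 := by nlinarith [norm_nonneg y]
      simp only [indicator_of_mem hy]
      rw [max_eq_left h0, (hFf y hy).lineDeriv_eq,
        (hf.differentiable (by simp) y).lineDeriv_eq_fderiv, mul_comm]
    · have hy' : r ≤ ‖y‖ := by simpa using hy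
      simp only [indicator_of_notMem hy]
      rw [max_eq_right (by nlinarith), mul_zero]
  · have hsph : ∀ᵐ y : E, y ∉ sphere (0 : E) r :=
      measure_eq_zero_iff_ae_notMem.1 (Measure.addHaar_sphere_of_ne_zero volume 0 hr.ne')
    filter_upwards [hsph] with y hy0
    have hy0' : ‖y‖ ≠ r := by simpa using hy0
    by_cases hy : y ∈ ball (0 : E) r
    · simp only [indicator_of_mem hy]
      have he : (fun y : E => max (r ^ 2 - ‖y‖ ^ 2) 0) =ᶠ[𝓝 y] fun y => r ^ 2 - ‖y‖ ^ 2 := by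
        filter_upwards [isOpen_ball.mem_nhds hy] with z hz
        have hz' : ‖z‖ < r := by simpa using hz
        exact max_eq_left (by nlinarith [norm_nonneg z])
      have hd : HasFDerivAt (fun y : E => r ^ 2 - ‖y‖ ^ 2) (-(2 • innerSL ℝ y)) y := by
        simpa using (hasStrictFDerivAt_norm_sq y).hasFDerivAt.const_sub (r ^ 2)
      rw [he.lineDeriv_eq, hd.differentiableAt.lineDeriv_eq_fderiv, hd.fderiv, hχ y hy]
      simp
      ring
    · have hy' : r < ‖y‖ := lt_of_le_of_ne (by simpa using hy) hy0'.symm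
      simp only [indicator_of_notMem hy]
      have he : (fun y : E => max (r ^ 2 - ‖y‖ ^ 2) 0) =ᶠ[𝓝 y] fun _ => 0 := by
        filter_upwards [continuous_norm.continuousAt.eventually (lt_mem_nhds hy')] with z hz
        exact max_eq_right (by nlinarith)
      rw [he.lineDeriv_eq]
      simp [lineDeriv]

variable [Nontrivial E]

/-- The divergence theorem on a ball, for the vector field `y ↦ f y • v`. -/
theorem setIntegral_ball_fderiv {f : E → ℝ} (hf : ContDiff ℝ 1 f) {r : ℝ} (hr : 0 < r) (v : E) :
    ∫ y in ball 0 r, fderiv ℝ f y v =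
      r ^ (finrank ℝ E - 1) * ∫ ω : sphere (0 : E) 1, inner ℝ (ω : E) v * f (r • (ω : E))
        ∂(volume : Measure E).toSphere := by
  have hg : Continuous fun y => fderiv ℝ f y v :=
    (hf.continuous_fderiv (by simp)).clm_apply continuous_const
  have hg2 : Continuous fun y : E => ‖y‖ ^ 2 * fderiv ℝ f y v := by fun_prop
  have hk : Continuous fun y : E => inner ℝ y v * f y :=
    (continuous_id.inner continuous_const).mul hf.continuous
  have hint {h : E → ℝ} (hh : Continuous h) (s : ℝ) : IntegrableOn h (ball 0 s) :=
    (hh.continuousOn.integrableOn_compact (isCompact_closedBall 0 s)).mono_set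
      ball_subset_closedBall
  have hA := ((hasDerivAt_pow 2 r).mul (hasDerivAt_setIntegral_ball hg hr)).sub
    (hasDerivAt_setIntegral_ball hg2 hr)
  have hB := (hasDerivAt_setIntegral_ball hk hr).const_mul 2
  have hAB : (fun s : ℝ => 2 * ∫ y in ball 0 s, inner ℝ y v * f y) =ᶠ[𝓝 r]
      ((fun s : ℝ => s ^ 2) * fun s => ∫ y in ball 0 s, fderiv ℝ f y v) -
        fun s => ∫ y in ball 0 s, ‖y‖ ^ 2 * fderiv ℝ f y v := by
    filter_upwards [lt_mem_nhds hr] with s hs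
    rw [← setIntegral_ball_mul_fderiv hf hs v]
    simp only [Pi.sub_apply, Pi.mul_apply]
    rw [← integral_const_mul, ← integral_sub ((hint hg s).const_mul _) (hint hg2 s)]
    simp only [sub_mul]
  have heq := (hA.congr_of_eventuallyEq hAB).unique hB
  have h1 : sphInt (fun y => ‖y‖ ^ 2 * fderiv ℝ f y v) r =
      r ^ 2 * sphInt (fun y => fderiv ℝ f y v) r := by
    rw [sphInt, sphInt, ← integral_const_mul]
    simp [norm_smul]
  have h2 : sphInt (fun y => inner ℝ y v * f y) r =
      r * ∫ ω : sphere (0 : E) 1, inner ℝ (ω : E) v * f (r • (ω : E))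
        ∂(volume : Measure E).toSphere := by
    rw [sphInt, ← integral_const_mul]
    simp [real_inner_smul_left, mul_assoc]
  rw [h1, h2] at heq
  have h2r : 2 * r ≠ 0 := by positivity
  apply mul_left_cancel₀ h2r
  simp at heq
  linarith

end Divergence

section SurfaceMeasure

/-- Two finite measures on a compact metric space which both give the same mass to all balls of the
same radius are proportional. -/
theorem integral_mul_real_univ_comm {X : Type*} [MetricSpace X] [CompactSpace X]
    [MeasurableSpace X] [BorelSpace X] (μ ν : Measure X) [IsFiniteMeasure μ] [IsFiniteMeasure ν]
    (hμ : ∀ ε x y, μ (ball x ε) = μ (ball y ε)) (hν : ∀ ε x y, ν (ball x ε) = ν (ball y ε))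
    {f : X → ℝ} (hf : Continuous f) :
    (∫ x, f x ∂μ) * ν.real univ = (∫ x, f x ∂ν) * μ.real univ := by
  rcases isEmpty_or_nonempty X with hX | ⟨⟨x₀⟩⟩
  · simp [Measure.eq_zero_of_isEmpty]
  by_cases hν0 : ν = 0
  · simp [hν0]
  have hfi (m : Measure X) [IsFiniteMeasure m] : Integrable f m :=
    hf.integrable_of_hasCompactSupport (HasCompactSupport.of_compactSpace f)
  -- the discrepancy is bounded by the oscillation of `f` at every scale
  suffices h : ∀ δ > 0, |(∫ x, f x ∂μ) * ν.real univ - (∫ x, f x ∂ν) * μ.real univ| ≤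
      δ * (μ.real univ * ν.real univ) by
    rw [← sub_eq_zero, ← abs_nonpos_iff]
    refine le_of_forall_pos_le_add fun η hη => ?_
    have hM : 0 ≤ μ.real univ * ν.real univ := by positivity
    refine (h (η / (μ.real univ * ν.real univ + 1)) (by positivity)).trans ?_
    rw [zero_add, div_mul_eq_mul_div, div_le_iff₀ (by positivity)]
    nlinarith
  intro δ hδ
  obtain ⟨ε, hε, hfε⟩ := Metric.uniformContinuous_iff.1
    (CompactSpace.uniformContinuous_of_continuous hf) δ hδ
  set a := μ.real (ball x₀ ε)
  set b := ν.real (ball x₀ ε)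
  have ha (x : X) : μ.real (ball x ε) = a := by simp only [a, Measure.real, hμ ε x x₀]
  have hb (x : X) : ν.real (ball x ε) = b := by simp only [b, Measure.real, hν ε x x₀]
  have hb0 : 0 < b := by
    refine lt_of_le_of_ne measureReal_nonneg fun h0 => hν0 ?_
    have hz (x : X) : ν (ball x ε) = 0 := by
      have := hb x
      rw [← h0, measureReal_eq_zero_iff] at this
      exact this
    obtain ⟨t, -, ht, hcov⟩ := (isCompact_univ (X := X)).finite_cover_balls hε
    rw [← Measure.measure_univ_eq_zero]
    exact measure_mono_null hcov ((measure_biUnion_null_iff ht.countable).2 fun x _ => hz x)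
  -- the pairs at distance less than `ε`
  set D : Set (X × X) := {p | dist p.1 p.2 < ε}
  have hDm : MeasurableSet D := (isOpen_lt continuous_dist continuous_const).measurableSet
  have hslice (x : X) : Prod.mk x ⁻¹' D = ball x ε := by
    ext y
    simp [D, dist_comm]
  have hslice' (y : X) : (fun x => (x, y)) ⁻¹' D = ball y ε := by
    ext x
    simp [D]
  have hf1 : Integrable (fun p : X × X => f p.1) (μ.prod ν) := (hfi μ).comp_fst ν
  have hf2 : Integrable (fun p : X × X => f p.2) (μ.prod ν) := (hfi ν).comp_snd μ
  have I1 : ∫ p in D, f p.1 ∂μ.prod ν = (∫ x, f x ∂μ) * b := by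
    rw [← integral_indicator hDm, integral_prod _ (hf1.indicator hDm), ← integral_mul_const]
    congr 1 with x
    have : (fun y => D.indicator (fun p : X × X => f p.1) (x, y)) =
        (ball x ε).indicator fun _ => f x := by
      rw [← hslice x]
      rfl
    rw [this, integral_indicator measurableSet_ball, setIntegral_const, hb, smul_eq_mul, mul_comm]
  have I2 : ∫ p in D, f p.2 ∂μ.prod ν = (∫ x, f x ∂ν) * a := by
    rw [← integral_indicator hDm, integral_prod_symm _ (hf2.indicator hDm), ← integral_mul_const]
    congr 1 with y
    have : (fun x => D.indicator (fun p : X × X => f p.2) (x, y)) =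
        (ball y ε).indicator fun _ => f y := by
      rw [← hslice' y]
      rfl
    rw [this, integral_indicator measurableSet_ball, setIntegral_const, ha, smul_eq_mul, mul_comm]
  have hD1 : (μ.prod ν).real D = μ.real univ * b := by
    rw [← mul_one ((μ.prod ν).real D), ← smul_eq_mul, ← setIntegral_const,
      ← integral_indicator hDm,
      integral_prod _ ((integrable_const (1 : ℝ)).indicator hDm)]
    have (x : X) : ∫ y, D.indicator (fun _ => (1 : ℝ)) (x, y) ∂ν = b := by
      have : (fun y => D.indicator (fun _ => (1 : ℝ)) (x, y)) =
          (ball x ε).indicator fun _ => 1 := by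
        rw [← hslice x]
        rfl
      rw [this, integral_indicator measurableSet_ball, setIntegral_const, hb, smul_eq_mul, mul_one]
    simp [this]
  have hD2 : (μ.prod ν).real D = ν.real univ * a := by
    rw [← mul_one ((μ.prod ν).real D), ← smul_eq_mul, ← setIntegral_const,
      ← integral_indicator hDm,
      integral_prod_symm _ ((integrable_const (1 : ℝ)).indicator hDm)]
    have (y : X) : ∫ x, D.indicator (fun _ => (1 : ℝ)) (x, y) ∂μ = a := by
      have : (fun x => D.indicator (fun _ => (1 : ℝ)) (x, y)) =
          (ball y ε).indicator fun _ => 1 := by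
        rw [← hslice' y]
        rfl
      rw [this, integral_indicator measurableSet_ball, setIntegral_const, ha, smul_eq_mul, mul_one]
    simp [this]
  have hdiff : |(∫ x, f x ∂μ) * b - (∫ x, f x ∂ν) * a| ≤ δ * (μ.real univ * b) := by
    rw [← I1, ← I2, ← integral_sub hf1.integrableOn hf2.integrableOn, ← hD1]
    rw [← Real.norm_eq_abs]
    refine norm_setIntegral_le_of_norm_le_const (measure_lt_top _ _) fun p hp => ?_
    have := hfε hp
    rw [Real.dist_eq, ← Real.norm_eq_abs] at this
    exact this.le
  have hab : μ.real univ * b = ν.real univ * a := hD1.symm.trans hD2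
  have hkey : (∫ x, f x ∂μ) * ν.real univ - (∫ x, f x ∂ν) * μ.real univ =
      ν.real univ / b * ((∫ x, f x ∂μ) * b - (∫ x, f x ∂ν) * a) := by
    field_simp
    linear_combination -(∫ x, f x ∂ν) * hab
  rw [hkey, abs_mul, abs_of_nonneg (by positivity)]
  calc _ ≤ ν.real univ / b * (δ * (μ.real univ * b)) := by gcongr
    _ = _ := by field_simp

variable {E : Type*} [NormedAddCommGroup E] [InnerProductSpace ℝ E] [FiniteDimensional ℝ E]
  [MeasurableSpace E] [BorelSpace E]

/-- A linear isometry of `E` acting on the unit sphere. -/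
def sphereIsometry (e : E ≃ₗᵢ[ℝ] E) : sphere (0 : E) 1 ≃ᵢ sphere (0 : E) 1 where
  toFun ω := ⟨e ω, by simp⟩
  invFun ω := ⟨e.symm ω, by simp⟩
  left_inv ω := by simp
  right_inv ω := by simp
  isometry_toFun ω ω' := e.isometry ω ω'

omit [FiniteDimensional ℝ E] [MeasurableSpace E] [BorelSpace E] in
@[simp]
theorem coe_sphereIsometry_apply (e : E ≃ₗᵢ[ℝ] E) (ω : sphere (0 : E) 1) :
    (sphereIsometry e ω : E) = e ω := rfl

omit [FiniteDimensional ℝ E] [MeasurableSpace E] [BorelSpace E] in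
theorem exists_sphereIsometry_apply_eq (ω ω' : sphere (0 : E) 1) :
    ∃ e : E ≃ₗᵢ[ℝ] E, sphereIsometry e ω = ω' :=
  ⟨_, Subtype.ext (Submodule.reflection_sub (v := (ω : E)) (w := ω') (by simp))⟩

omit [FiniteDimensional ℝ E] in
theorem hausdorffMeasure_sphere_ball_eq (d ε : ℝ) (x y : sphere (0 : E) 1) :
    μH[d] (ball x ε) = μH[d] (ball y ε) := by
  obtain ⟨e, rfl⟩ := exists_sphereIsometry_apply_eq x y
  rw [← (sphereIsometry e).image_ball, (sphereIsometry e).hausdorffMeasure_image]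

open scoped Pointwise in
theorem toSphere_ball_eq (ε : ℝ) (x y : sphere (0 : E) 1) :
    (volume : Measure E).toSphere (ball x ε) = (volume : Measure E).toSphere (ball y ε) := by
  obtain ⟨e, rfl⟩ := exists_sphereIsometry_apply_eq x y
  rw [Measure.toSphere_apply' _ measurableSet_ball, Measure.toSphere_apply' _ measurableSet_ball,
    ← (sphereIsometry e).image_ball]
  have : Ioo (0 : ℝ) 1 • ((↑) '' (sphereIsometry e '' ball x ε) : Set E) =
      e '' (Ioo (0 : ℝ) 1 • ((↑) '' ball x ε)) := by
    ext z
    simp only [Set.mem_smul, mem_image]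
    constructor
    · rintro ⟨t, ht, _, ⟨_, ⟨w, hw, rfl⟩, rfl⟩, rfl⟩
      exact ⟨t • (w : E), ⟨t, ht, _, ⟨w, hw, rfl⟩, rfl⟩, by simp⟩
    · rintro ⟨_, ⟨t, ht, _, ⟨w, hw, rfl⟩, rfl⟩, rfl⟩
      exact ⟨t, ht, _, ⟨_, ⟨w, hw, rfl⟩, rfl⟩, by simp⟩
  rw [this, LinearIsometryEquiv.image_eq_preimage_symm,
    e.symm.measurePreserving.measure_preimage_emb e.symm.toHomeomorph.measurableEmbedding]

omit [FiniteDimensional ℝ E] in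
theorem setIntegral_sphere_hausdorffMeasure {d : ℝ} (hd : 0 ≤ d) (f : E → ℝ) {r : ℝ} (hr : 0 < r) :
    ∫ y in sphere 0 r, f y ∂μH[d] = r ^ d * ∫ ω : sphere (0 : E) 1, f (r • (ω : E)) ∂μH[d] := by
  have hval : ∫ ω : sphere (0 : E) 1, f (r • (ω : E)) ∂μH[d] =
      ∫ y in sphere (0 : E) 1, f (r • y) ∂μH[d] := by
    have h := isometry_subtype_coe (s := sphere (0 : E) 1).map_hausdorffMeasure (d := d) (.inl hd)
    rw [Subtype.range_coe] at h
    rw [← h, (MeasurableEmbedding.subtype_coe isClosed_sphere.measurableSet).integral_map]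
  have hemb : MeasurableEmbedding (fun y : E => r • y) :=
    (Homeomorph.smulOfNeZero r hr.ne').measurableEmbedding
  have hmap : Measure.map (fun y : E => r • y) μH[d] = ‖r‖₊⁻¹ ^ d • (μH[d] : Measure E) := by
    rw [← map_homothety_hausdorffMeasure hd (0 : E) hr.ne']
    congr 1
    ext y
    simp [AffineMap.homothety_apply]
  have hpre : (fun y : E => r • y) ⁻¹' sphere 0 r = sphere 0 1 := by
    ext y
    simp [norm_smul, abs_of_pos hr, hr.ne']
  have h := hemb.setIntegral_map (μ := μH[d]) f (sphere 0 r)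
  rw [hmap, hpre, Measure.restrict_smul, integral_smul_nnreal_measure] at h
  rw [hval, ← h, NNReal.smul_def, smul_eq_mul, NNReal.coe_rpow, NNReal.coe_inv, coe_nnnorm,
    Real.norm_of_nonneg hr.le, ← mul_assoc, Real.inv_rpow hr.le,
    mul_inv_cancel₀ (Real.rpow_pos_of_pos hr d).ne', one_mul]

/-- Up to a constant, the surface integral of a positive function with respect to the Hausdorff
measure is the one that occurs in polar coordinates. -/
theorem exists_setIntegral_sphere_eq_mul_sphInt [Nontrivial E] :
    ∃ c : ℝ, 0 ≤ c ∧ ∀ f : E → ℝ, Continuous f → (∀ y, 0 < f y) → ∀ r : ℝ, 0 < r →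
      ∫ y in sphere 0 r, f y ∂μH[(finrank ℝ E : ℝ) - 1] =
        c * (r ^ (finrank ℝ E - 1) * sphInt f r) := by
  have hdim : 1 ≤ finrank ℝ E := finrank_pos
  have hd : (0 : ℝ) ≤ (finrank ℝ E : ℝ) - 1 := by
    rw [sub_nonneg]
    exact_mod_cast hdim
  set d : ℝ := (finrank ℝ E : ℝ) - 1 with hd_def
  have hpow (r : ℝ) : r ^ d = r ^ (finrank ℝ E - 1) := by
    rw [hd_def, ← Nat.cast_pred hdim, Real.rpow_natCast]
  by_cases hfin : μH[d] (univ : Set (sphere (0 : E) 1)) = ⊤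
  · refine ⟨0, le_rfl, fun f hf hpos r hr => ?_⟩
    rw [setIntegral_sphere_hausdorffMeasure hd f hr, zero_mul]
    refine mul_eq_zero_of_right _ (integral_undef fun hi => ?_)
    obtain ⟨ω₀⟩ : Nonempty (sphere (0 : E) 1) :=
      (NormedSpace.sphere_nonempty.2 zero_le_one).to_subtype
    obtain ⟨ω, -, hω⟩ := isCompact_univ.exists_isMinOn ⟨ω₀, mem_univ _⟩
      (continuous_smul_sphere hf r).continuousOn
    have h := hi.measure_norm_ge_lt_top (hpos (r • (ω : E)))
    refine h.ne (le_antisymm le_top (hfin ▸ measure_mono fun ω' _ => ?_))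
    have hle : f (r • (ω : E)) ≤ f (r • (ω' : E)) := hω (mem_univ ω')
    exact hle.trans (le_abs_self _)
  · have : IsFiniteMeasure (μH[d] : Measure (sphere (0 : E) 1)) := ⟨lt_top_iff_ne_top.2 hfin⟩
    set σ := (volume : Measure E).toSphere
    have hσ : σ.real univ ≠ 0 := by
      rw [measureReal_ne_zero_iff, Measure.measure_univ_ne_zero]
      exact Measure.toSphere_ne_zero _
    refine ⟨μH[d].real (univ : Set (sphere (0 : E) 1)) / σ.real univ, by positivity,
      fun f hf _ r hr => ?_⟩
    have h := integral_mul_real_univ_comm μH[d] σ (hausdorffMeasure_sphere_ball_eq d)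
      toSphere_ball_eq (continuous_smul_sphere hf r)
    rw [setIntegral_sphere_hausdorffMeasure hd f hr, hpow, sphInt, eq_div_of_mul_eq hσ h]
    ring

end SurfaceMeasure

section Coordinates

variable {n : ℕ}

/-- The partial derivative in the `i`-th coordinate direction. -/
def pd (i : Fin n) (f : EuclideanSpace ℝ (Fin n) → ℝ) (y : EuclideanSpace ℝ (Fin n)) : ℝ :=
  fderiv ℝ f y (EuclideanSpace.single i 1)

variable {f g : EuclideanSpace ℝ (Fin n) → ℝ}

theorem contDiff_pd (hf : ContDiff ℝ (⊤ : ℕ∞) f) (i : Fin n) : ContDiff ℝ (⊤ : ℕ∞) (pd i f) :=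
  (hf.fderiv_right (m := (⊤ : ℕ∞)) (by simp)).clm_apply contDiff_const

theorem fderiv_apply_eq_sum_pd (y w : EuclideanSpace ℝ (Fin n)) :
    fderiv ℝ f y w = ∑ i, w i * pd i f y := by
  conv_lhs => rw [← (EuclideanSpace.basisFun (Fin n) ℝ).sum_repr w]
  simp [pd]

theorem norm_gradient_sq (y : EuclideanSpace ℝ (Fin n)) :
    ‖gradient f y‖ ^ 2 = ∑ i, pd i f y ^ 2 := by
  rw [EuclideanSpace.real_norm_sq_eq]
  refine Finset.sum_congr rfl fun i _ => ?_
  have : gradient f y i = pd i f y := by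
    have h := InnerProductSpace.toDual_symm_apply (𝕜 := ℝ) (x := EuclideanSpace.single i (1 : ℝ))
      (y := fderiv ℝ f y)
    rw [EuclideanSpace.inner_single_right] at h
    simpa [gradient, pd] using h
  rw [this]

theorem pd_pd (hf : ContDiff ℝ (⊤ : ℕ∞) f) (i j : Fin n) (y : EuclideanSpace ℝ (Fin n)) :
    pd i (pd j f) y =
      fderiv ℝ (fderiv ℝ f) y (EuclideanSpace.single i 1) (EuclideanSpace.single j 1) := by
  have hd : DifferentiableAt ℝ (fderiv ℝ f) y :=
    (hf.fderiv_right (m := (⊤ : ℕ∞)) (by simp)).differentiable (by simp) y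
  have : HasFDerivAt (pd j f) _ y := hd.hasFDerivAt.clm_apply (hasFDerivAt_const _ y)
  rw [pd, this.fderiv]
  simp

theorem pd_comm (hf : ContDiff ℝ (⊤ : ℕ∞) f) (i j : Fin n) (y : EuclideanSpace ℝ (Fin n)) :
    pd i (pd j f) y = pd j (pd i f) y := by
  rw [pd_pd hf, pd_pd hf]
  exact (hf.contDiffAt.isSymmSndFDerivAt
    (by
      rw [minSmoothness_of_isRCLikeNormedField]
      exact WithTop.coe_le_coe.2 (le_top : (2 : ℕ∞) ≤ ⊤))).eq _ _

theorem lap_eq_sum_pd (hf : ContDiff ℝ (⊤ : ℕ∞) f) (y : EuclideanSpace ℝ (Fin n)) :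
    lap f y = ∑ i, pd i (pd i f) y := by
  simp [lap, iteratedFDeriv_two_apply, pd_pd hf]

theorem pd_add (hf : Differentiable ℝ f) (hg : Differentiable ℝ g) (i : Fin n)
    (y : EuclideanSpace ℝ (Fin n)) :
    pd i (fun y => f y + g y) y = pd i f y + pd i g y := by
  simp [pd, fderiv_fun_add (hf y) (hg y)]

theorem pd_sub (hf : Differentiable ℝ f) (hg : Differentiable ℝ g) (i : Fin n)
    (y : EuclideanSpace ℝ (Fin n)) :
    pd i (fun y => f y - g y) y = pd i f y - pd i g y := by
  simp [pd, fderiv_fun_sub (hf y) (hg y)]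

theorem pd_mul (hf : Differentiable ℝ f) (hg : Differentiable ℝ g) (i : Fin n)
    (y : EuclideanSpace ℝ (Fin n)) :
    pd i (fun y => f y * g y) y = pd i f y * g y + f y * pd i g y := by
  simp [pd, fderiv_fun_mul (hf y) (hg y)]
  ring

theorem pd_sq (hf : Differentiable ℝ f) (i : Fin n) (y : EuclideanSpace ℝ (Fin n)) :
    pd i (fun y => f y ^ 2) y = 2 * f y * pd i f y := by
  simp only [sq, pd_mul hf hf]
  ring

theorem pd_const_mul (c : ℝ) (hf : Differentiable ℝ f) (i : Fin n)
    (y : EuclideanSpace ℝ (Fin n)) : pd i (fun y => c * f y) y = c * pd i f y := by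
  simp [pd, fderiv_const_mul (hf y)]

theorem pd_sum {ι : Type*} [Fintype ι] {F : ι → EuclideanSpace ℝ (Fin n) → ℝ}
    (hF : ∀ j, Differentiable ℝ (F j)) (i : Fin n) (y : EuclideanSpace ℝ (Fin n)) :
    pd i (fun y => ∑ j, F j y) y = ∑ j, pd i (F j) y := by
  simp [pd, fderiv_fun_sum fun j _ => hF j y]

theorem pd_coord (i j : Fin n) (y : EuclideanSpace ℝ (Fin n)) :
    pd i (fun y => y j) y = if j = i then 1 else 0 := by
  have : HasFDerivAt (fun y : EuclideanSpace ℝ (Fin n) => y j)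
      (EuclideanSpace.proj (𝕜 := ℝ) j : EuclideanSpace ℝ (Fin n) →L[ℝ] ℝ) y :=
    (EuclideanSpace.proj (𝕜 := ℝ) j).hasFDerivAt
  rw [pd, this.fderiv]
  simp

/-- The divergence of the vector field `y ↦ g y • y`. -/
theorem sum_pd_coord_mul (hg : Differentiable ℝ g) (y : EuclideanSpace ℝ (Fin n)) :
    ∑ i, pd i (fun y => y i * g y) y = n * g y + ∑ i, y i * pd i g y := by
  have hc (i : Fin n) : Differentiable ℝ fun y : EuclideanSpace ℝ (Fin n) => y i := by fun_prop
  simp [pd_mul (hc _) hg, pd_coord, Finset.sum_add_distrib]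

/-- Rellich's identity. -/
theorem sum_pd_rellich (hf : ContDiff ℝ (⊤ : ℕ∞) f) (y : EuclideanSpace ℝ (Fin n)) :
    ∑ i, pd i (fun y => y i * ∑ j, pd j f y ^ 2 - 2 * ((∑ j, y j * pd j f y) * pd i f y)) y =
      (n - 2) * ∑ i, pd i f y ^ 2 - 2 * (∑ j, y j * pd j f y) * lap f y := by
  have hc (i : Fin n) : Differentiable ℝ fun y : EuclideanSpace ℝ (Fin n) => y i := by fun_prop
  have hp (i : Fin n) : Differentiable ℝ (pd i f) := (contDiff_pd hf i).differentiable (by simp)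
  have hG : Differentiable ℝ fun y => ∑ j, pd j f y ^ 2 :=
    Differentiable.fun_sum fun j _ => (hp j).pow 2
  have hE : Differentiable ℝ fun y : EuclideanSpace ℝ (Fin n) => ∑ j, y j * pd j f y :=
    Differentiable.fun_sum fun j _ => (hc j).mul (hp j)
  have h1 := sum_pd_coord_mul hG y
  have h2 (i : Fin n) : pd i (fun y => ∑ j, y j * pd j f y) y =
      pd i f y + ∑ j, y j * pd i (pd j f) y := by
    simp [pd_sum (fun j => (hc j).fun_mul (hp j)), pd_mul (hc _) (hp _), pd_coord,
      Finset.sum_add_distrib]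
  have h3 (i : Fin n) : pd i (fun y => ∑ j, pd j f y ^ 2) y =
      2 * ∑ j, pd j f y * pd i (pd j f) y := by
    simp [pd_sum (fun j => (hp j).fun_pow 2), pd_sq (hp _), Finset.mul_sum, mul_assoc]
  have h4 : ∑ i, (∑ j, y j * pd i (pd j f) y) * pd i f y =
      ∑ i, y i * ∑ j, pd j f y * pd i (pd j f) y := by
    simp only [Finset.sum_mul, Finset.mul_sum]
    rw [Finset.sum_comm]
    refine Finset.sum_congr rfl fun i _ => Finset.sum_congr rfl fun j _ => ?_
    rw [pd_comm hf]
    ring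
  have h5 (i : Fin n) : pd i (fun y => y i * ∑ j, pd j f y ^ 2 -
      2 * ((∑ j, y j * pd j f y) * pd i f y)) y = pd i (fun y => y i * ∑ j, pd j f y ^ 2) y -
      2 * (pd i f y ^ 2 + (∑ j, y j * pd i (pd j f) y) * pd i f y +
        (∑ j, y j * pd j f y) * pd i (pd i f) y) := by
    rw [pd_sub ((hc i).fun_mul hG) ((hE.fun_mul (hp i)).const_mul 2),
      pd_const_mul 2 (hE.fun_mul (hp i)), pd_mul hE (hp i), h2]
    ring
  simp only [h5, Finset.sum_sub_distrib, ← Finset.mul_sum, Finset.sum_add_distrib]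
  rw [h1, h4, lap_eq_sum_pd hf]
  simp only [h3]
  have h6 : ∑ i, y i * (2 * ∑ j, pd j f y * pd i (pd j f) y) =
      2 * ∑ i, y i * ∑ j, pd j f y * pd i (pd j f) y := by
    rw [Finset.mul_sum]
    exact Finset.sum_congr rfl fun i _ => by ring
  rw [h6]
  ring

/-- The divergence theorem on a ball in `ℝⁿ`. -/
theorem setIntegral_ball_divergence [NeZero n] {X : Fin n → EuclideanSpace ℝ (Fin n) → ℝ}
    (hX : ∀ i, ContDiff ℝ 1 (X i)) {r : ℝ} (hr : 0 < r) :
    ∫ y in ball 0 r, ∑ i, pd i (X i) y =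
      r ^ (n - 1) * ∫ ω : sphere (0 : EuclideanSpace ℝ (Fin n)) 1,
        ∑ i, (ω : EuclideanSpace ℝ (Fin n)) i * X i (r • (ω : EuclideanSpace ℝ (Fin n)))
        ∂(volume : Measure (EuclideanSpace ℝ (Fin n))).toSphere := by
  rw [integral_finsetSum, integral_finsetSum, Finset.mul_sum]
  · refine Finset.sum_congr rfl fun i _ => ?_
    simpa [EuclideanSpace.inner_single_right, pd] using
      setIntegral_ball_fderiv (hX i) hr (EuclideanSpace.single i 1)
  · intro i _
    refine integrable_sphere ?_ _
    have := (hX i).continuous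
    fun_prop
  · intro i _
    refine IntegrableOn.mono_set (ContinuousOn.integrableOn_compact (isCompact_closedBall 0 r)
      (Continuous.continuousOn ?_)) ball_subset_closedBall
    exact ((hX i).continuous_fderiv (by simp)).clm_apply continuous_const

end Coordinates

section Monotonicity

/-- The calculus behind Almgren's monotonicity formula: `D` and `P` are the bulk integrals, `h`,
`e`, `q`, `m` are spherical means of `u² + v²`, of the energy density, of `u_ν² + v_ν²` and of
`u u_ν + v v_ν`. -/
theorem monotoneOn_frequency {k : ℕ} {D P h e q m : ℝ → ℝ}
    (hD : ∀ r, 0 < r → HasDerivAt D (r ^ (k + 1) * e r) r)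
    (hh : ∀ r, 0 < r → HasDerivAt h (2 * m r) r)
    (hpos : ∀ r, 0 < r → 0 < h r) (hD0 : ∀ r, 0 < r → 0 ≤ D r) (hP : ∀ r, 0 < r → 0 ≤ P r)
    (hm : ∀ r, 0 < r → r ^ (k + 1) * m r = D r + P r)
    (hpoh : ∀ r, 0 < r → r ^ (k + 2) * (e r - 2 * q r) = k * D r + 2 * P r)
    (hcs : ∀ r, 0 < r → m r ^ 2 ≤ q r * h r) :
    MonotoneOn (fun r => r * D r / (r ^ (k + 1) * h r)) (Ioi 0) := by
  have hderiv (r : ℝ) (hr : 0 < r) := ((hasDerivAt_id' r).fun_mul (hD r hr)).fun_div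
    ((hasDerivAt_pow (k + 1) r).fun_mul (hh r hr)) (mul_pos (pow_pos hr _) (hpos r hr)).ne'
  refine monotoneOn_of_deriv_nonneg (convex_Ioi 0)
    (fun r hr => (hderiv r hr).continuousAt.continuousWithinAt)
    (fun r hr => (hderiv r (interior_subset hr)).differentiableAt.differentiableWithinAt)
    fun r hr => ?_
  replace hr : 0 < r := interior_subset hr
  have h0 := hpos r hr
  have hm0 : 0 ≤ m r := by
    have : 0 ≤ r ^ (k + 1) * m r := by
      rw [hm r hr]
      exact add_nonneg (hD0 r hr) (hP r hr)
    exact nonneg_of_mul_nonneg_right this (pow_pos hr _)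
  rw [(hderiv r hr).deriv]
  refine div_nonneg ?_ (sq_nonneg _)
  have key : (1 * D r + r * (r ^ (k + 1) * e r)) * (r ^ (k + 1) * h r) -
      r * D r * (((k + 1 : ℕ) : ℝ) * r ^ (k + 1 - 1) * h r + r ^ (k + 1) * (2 * m r)) =
      2 * r ^ (k + 1) * (r ^ (k + 2) * (q r * h r - m r ^ 2) + P r * h r + r * P r * m r) := by
    have h1 := hm r hr
    have h2 := hpoh r hr
    simp only [Nat.add_sub_cancel]
    push_cast
    linear_combination (r ^ (k + 1) * h r) * h2 + (2 * r ^ (k + 2) * m r) * h1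
  rw [key]
  have := sub_nonneg.2 (hcs r hr)
  have := hP r hr
  positivity

variable {n : ℕ} {u v : EuclideanSpace ℝ (Fin n) → ℝ}

/-- The Cauchy-Schwarz inequality for pairs of functions. -/
theorem sq_integral_le_integral_mul_integral {X : Type*} [MeasurableSpace X] {μ : Measure X}
    {a b c d : X → ℝ} (h1 : Integrable (fun x => a x * c x + b x * d x) μ)
    (h2 : Integrable (fun x => a x ^ 2 + b x ^ 2) μ)
    (h3 : Integrable (fun x => c x ^ 2 + d x ^ 2) μ) (hpos : 0 < ∫ x, a x ^ 2 + b x ^ 2 ∂μ) :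
    (∫ x, a x * c x + b x * d x ∂μ) ^ 2 ≤
      (∫ x, c x ^ 2 + d x ^ 2 ∂μ) * ∫ x, a x ^ 2 + b x ^ 2 ∂μ := by
  set h := ∫ x, a x ^ 2 + b x ^ 2 ∂μ
  set m := ∫ x, a x * c x + b x * d x ∂μ
  have hnn : 0 ≤ ∫ x, m ^ 2 * (a x ^ 2 + b x ^ 2) - 2 * m * h * (a x * c x + b x * d x) +
      h ^ 2 * (c x ^ 2 + d x ^ 2) ∂μ :=
    integral_nonneg fun x => by
      change 0 ≤ m ^ 2 * (a x ^ 2 + b x ^ 2) - 2 * m * h * (a x * c x + b x * d x) +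
        h ^ 2 * (c x ^ 2 + d x ^ 2)
      nlinarith [sq_nonneg (m * a x - h * c x), sq_nonneg (m * b x - h * d x)]
  have hi : Integrable (fun x => m ^ 2 * (a x ^ 2 + b x ^ 2) -
      2 * m * h * (a x * c x + b x * d x)) μ := (h2.const_mul _).sub (h1.const_mul _)
  rw [integral_add hi (h3.const_mul _),
    integral_sub (h2.const_mul _) (h1.const_mul _), integral_const_mul, integral_const_mul,
    integral_const_mul] at hnn
  refine le_of_mul_le_mul_left ?_ hpos
  nlinarith

theorem contDiff_energy (hu : ContDiff ℝ (⊤ : ℕ∞) u) (hv : ContDiff ℝ (⊤ : ℕ∞) v) :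
    ContDiff ℝ (⊤ : ℕ∞) fun y => (∑ i, pd i u y ^ 2) + (∑ i, pd i v y ^ 2) + u y ^ 2 * v y ^ 2 :=
  ((ContDiff.sum fun i _ => (contDiff_pd hu i).pow 2).add
    (ContDiff.sum fun i _ => (contDiff_pd hv i).pow 2)).add ((hu.pow 2).mul (hv.pow 2))

/-- The energy identity, obtained by testing the system with `(u, v)`. -/
theorem IsSolution.sphere_normal_eq [NeZero n] (hsol : IsSolution u v) {r : ℝ} (hr : 0 < r) :
    r ^ (n - 1) * ∫ ω : sphere (0 : EuclideanSpace ℝ (Fin n)) 1,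
        u (r • ω) * fderiv ℝ u (r • ω) ω + v (r • ω) * fderiv ℝ v (r • ω) ω
        ∂(volume : Measure (EuclideanSpace ℝ (Fin n))).toSphere =
      bulk u v 0 r + ∫ y in ball 0 r, u y ^ 2 * v y ^ 2 := by
  obtain ⟨hu, hv, -, -, hlu, hlv⟩ := hsol
  have hpu (i : Fin n) := contDiff_pd hu i
  have hpv (i : Fin n) := contDiff_pd hv i
  have hdu := hu.differentiable (by simp)
  have hdv := hv.differentiable (by simp)
  have hdpu (i : Fin n) := (hpu i).differentiable (by simp)
  have hdpv (i : Fin n) := (hpv i).differentiable (by simp)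
  have h := setIntegral_ball_divergence (X := fun i y => u y * pd i u y + v y * pd i v y)
    (fun i => ((hu.mul (hpu i)).add (hv.mul (hpv i))).of_le (by simp)) hr
  have hcont {f : EuclideanSpace ℝ (Fin n) → ℝ} (hf : Continuous f) : IntegrableOn f (ball 0 r) :=
    (hf.continuousOn.integrableOn_compact (isCompact_closedBall 0 r)).mono_set
      ball_subset_closedBall
  simp only [bulk, norm_gradient_sq]
  rw [← integral_add (hcont (contDiff_energy hu hv).continuous)
    (hcont ((hu.pow 2).mul (hv.pow 2)).continuous)]
  refine Eq.trans ?_ (h.symm.trans ?_)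
  · congr 2 with ω
    simp only [fderiv_apply_eq_sum_pd, Finset.mul_sum, ← Finset.sum_add_distrib]
    exact Finset.sum_congr rfl fun i _ => by ring
  · congr 1 with y
    have hi (i : Fin n) : pd i (fun y => u y * pd i u y + v y * pd i v y) y =
        (pd i u y ^ 2 + u y * pd i (pd i u) y) + (pd i v y ^ 2 + v y * pd i (pd i v) y) := by
      rw [pd_add (hdu.fun_mul (hdpu i)) (hdv.fun_mul (hdpv i)), pd_mul hdu (hdpu i),
        pd_mul hdv (hdpv i)]
      ring
    simp only [hi, Finset.sum_add_distrib, ← Finset.mul_sum]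
    rw [← lap_eq_sum_pd hu, ← lap_eq_sum_pd hv, hlu, hlv]
    ring

/-- The Pohozaev identity, obtained by testing the system with `(y · ∇u, y · ∇v)`. -/
theorem IsSolution.pohozaev [NeZero n] (hsol : IsSolution u v) {r : ℝ} (hr : 0 < r) :
    r ^ (n - 1) * r * (sphInt (fun y => ‖gradient u y‖ ^ 2 + ‖gradient v y‖ ^ 2 +
          u y ^ 2 * v y ^ 2) r -
        2 * ∫ ω : sphere (0 : EuclideanSpace ℝ (Fin n)) 1,
          fderiv ℝ u (r • ω) ω ^ 2 + fderiv ℝ v (r • ω) ω ^ 2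
          ∂(volume : Measure (EuclideanSpace ℝ (Fin n))).toSphere) =
      (n - 2) * bulk u v 0 r + 2 * ∫ y in ball 0 r, u y ^ 2 * v y ^ 2 := by
  obtain ⟨hu, hv, -, -, hlu, hlv⟩ := hsol
  have hpu (i : Fin n) := contDiff_pd hu i
  have hpv (i : Fin n) := contDiff_pd hv i
  have hdu := hu.differentiable (by simp)
  have hdv := hv.differentiable (by simp)
  have hc (i : Fin n) : ContDiff ℝ (⊤ : ℕ∞) fun y : EuclideanSpace ℝ (Fin n) => y i := by fun_prop
  have hW : ContDiff ℝ (⊤ : ℕ∞) fun y => u y ^ 2 * v y ^ 2 := (hu.pow 2).mul (hv.pow 2)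
  have hR {f : EuclideanSpace ℝ (Fin n) → ℝ} (hf : ContDiff ℝ (⊤ : ℕ∞) f) (i : Fin n) :
      ContDiff ℝ (⊤ : ℕ∞) fun y =>
        y i * ∑ j, pd j f y ^ 2 - 2 * ((∑ j, y j * pd j f y) * pd i f y) :=
    ((hc i).mul (ContDiff.sum fun j _ => (contDiff_pd hf j).pow 2)).sub
      (contDiff_const.mul ((ContDiff.sum fun j _ => (hc j).mul (contDiff_pd hf j)).mul
        (contDiff_pd hf i)))
  have hcW (i : Fin n) : ContDiff ℝ (⊤ : ℕ∞) fun y => y i * (u y ^ 2 * v y ^ 2) := (hc i).mul hW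
  have h := setIntegral_ball_divergence (X := fun i y =>
    (y i * ∑ j, pd j u y ^ 2 - 2 * ((∑ j, y j * pd j u y) * pd i u y)) +
    (y i * ∑ j, pd j v y ^ 2 - 2 * ((∑ j, y j * pd j v y) * pd i v y)) +
    y i * (u y ^ 2 * v y ^ 2)) (fun i => (((hR hu i).add (hR hv i)).add (hcW i)).of_le (by simp)) hr
  have hcont {f : EuclideanSpace ℝ (Fin n) → ℝ} (hf : Continuous f) : IntegrableOn f (ball 0 r) :=
    (hf.continuousOn.integrableOn_compact (isCompact_closedBall 0 r)).mono_set
      ball_subset_closedBall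
  have hcr {f : EuclideanSpace ℝ (Fin n) → ℝ} (hf : ContDiff ℝ (⊤ : ℕ∞) f) :
      Continuous fun ω : sphere (0 : EuclideanSpace ℝ (Fin n)) 1 =>
        fderiv ℝ f (r • (ω : EuclideanSpace ℝ (Fin n))) ω :=
    ((hf.continuous_fderiv (by simp)).comp (by fun_prop)).clm_apply continuous_subtype_val
  simp only [bulk, norm_gradient_sq]
  have hrhs : ((n : ℝ) - 2) * ∫ y in ball 0 r,
        ((∑ i, pd i u y ^ 2) + (∑ i, pd i v y ^ 2) + u y ^ 2 * v y ^ 2) = ∫ y in ball 0 r,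
        (n - 2) * ((∑ i, pd i u y ^ 2) + (∑ i, pd i v y ^ 2) + u y ^ 2 * v y ^ 2) :=
    (integral_const_mul _ _).symm
  have hrhs' : 2 * ∫ y in ball 0 r, u y ^ 2 * v y ^ 2 = ∫ y in ball 0 r,
      2 * (u y ^ 2 * v y ^ 2) := (integral_const_mul _ _).symm
  rw [hrhs, hrhs', ← integral_add ((hcont (contDiff_energy hu hv).continuous).const_mul _)
    ((hcont hW.continuous).const_mul _), mul_assoc]
  refine Eq.trans ?_ (h.symm.trans ?_)
  · have hn : Continuous fun ω : sphere (0 : EuclideanSpace ℝ (Fin n)) 1 =>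
        fderiv ℝ u (r • ω) ω ^ 2 + fderiv ℝ v (r • ω) ω ^ 2 :=
      ((hcr hu).pow 2).add ((hcr hv).pow 2)
    rw [sphInt, ← integral_const_mul, ← integral_sub
      (integrable_sphere (continuous_smul_sphere (contDiff_energy hu hv).continuous r) _)
      ((integrable_sphere hn _).const_mul 2), ← integral_const_mul]
    congr 2 with ω
    have hω : ∑ i, (ω : EuclideanSpace ℝ (Fin n)) i ^ 2 = 1 := by
      rw [← EuclideanSpace.real_norm_sq_eq]
      simp
    set y := r • (ω : EuclideanSpace ℝ (Fin n)) with hy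
    have hyi (i : Fin n) : y i = r * (ω : EuclideanSpace ℝ (Fin n)) i := by simp [hy]
    have hrad (f : EuclideanSpace ℝ (Fin n) → ℝ) :
        ∑ j, y j * pd j f y = r * fderiv ℝ f y ω := by
      simp only [fderiv_apply_eq_sum_pd, Finset.mul_sum, hyi, mul_assoc]
    have hterm (i : Fin n) : (ω : EuclideanSpace ℝ (Fin n)) i *
        ((y i * ∑ j, pd j u y ^ 2 - 2 * ((∑ j, y j * pd j u y) * pd i u y)) +
        (y i * ∑ j, pd j v y ^ 2 - 2 * ((∑ j, y j * pd j v y) * pd i v y)) +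
        y i * (u y ^ 2 * v y ^ 2)) =
        r * (∑ j, pd j u y ^ 2 + ∑ j, pd j v y ^ 2 + u y ^ 2 * v y ^ 2) *
          (ω : EuclideanSpace ℝ (Fin n)) i ^ 2 -
        2 * r * fderiv ℝ u y ω * ((ω : EuclideanSpace ℝ (Fin n)) i * pd i u y) -
        2 * r * fderiv ℝ v y ω * ((ω : EuclideanSpace ℝ (Fin n)) i * pd i v y) := by
      rw [hrad, hrad, hyi]
      ring
    rw [Finset.sum_congr rfl fun i _ => hterm i]
    simp only [Finset.sum_sub_distrib, ← Finset.mul_sum, hω, ← fderiv_apply_eq_sum_pd]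
    ring
  · congr 1 with y
    have hd {f : EuclideanSpace ℝ (Fin n) → ℝ} (hf : ContDiff ℝ (⊤ : ℕ∞) f) :
      Differentiable ℝ f := hf.differentiable (by simp)
    have hi (i : Fin n) := pd_add (hd ((hR hu i).add (hR hv i))) (hd (hcW i)) i y
    have hi' (i : Fin n) := pd_add (hd (hR hu i)) (hd (hR hv i)) i y
    have hWi (i : Fin n) : y i * pd i (fun y => u y ^ 2 * v y ^ 2) y =
        2 * u y * v y ^ 2 * (y i * pd i u y) + 2 * v y * u y ^ 2 * (y i * pd i v y) := by
      rw [pd_mul (hdu.fun_pow 2) (hdv.fun_pow 2), pd_sq hdu, pd_sq hdv]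
      ring
    simp only [hi, hi', Finset.sum_add_distrib]
    rw [sum_pd_rellich hu, sum_pd_rellich hv, sum_pd_coord_mul (hd hW), hlu, hlv]
    simp only [hWi, Finset.sum_add_distrib, ← Finset.mul_sum]
    ring

theorem IsSolution.comp_add_left (hsol : IsSolution u v) (x : EuclideanSpace ℝ (Fin n)) :
    IsSolution (fun y => u (x + y)) (fun y => v (x + y)) := by
  obtain ⟨hu, hv, hpu, hpv, hlu, hlv⟩ := hsol
  refine ⟨hu.comp (by fun_prop), hv.comp (by fun_prop), fun y => hpu _, fun y => hpv _,
    fun y => ?_, fun y => ?_⟩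
  · simpa only [lap, iteratedFDeriv_comp_add_left] using hlu (x + y)
  · simpa only [lap, iteratedFDeriv_comp_add_left] using hlv (x + y)

theorem freq_comp_add_left (x : EuclideanSpace ℝ (Fin n)) (r : ℝ) :
    freq (fun y => u (x + y)) (fun y => v (x + y)) 0 r = freq u v x r := by
  have hb : bulk (fun y => u (x + y)) (fun y => v (x + y)) 0 r = bulk u v x r := by
    have hpre : (fun y => x + y) ⁻¹' ball x r = ball 0 r := by
      ext y
      simp
    have h := (measurePreserving_add_left volume x).setIntegral_preimage_emb
      (measurableEmbedding_addLeft x)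
      (fun y => ‖gradient u y‖ ^ 2 + ‖gradient v y‖ ^ 2 + u y ^ 2 * v y ^ 2) (ball x r)
    rw [hpre] at h
    rw [bulk, bulk, ← h]
    simp only [gradient, fderiv_comp_add_left]
  have hs : bdry (fun y => u (x + y)) (fun y => v (x + y)) 0 r = bdry u v x r := by
    have hpre : (fun y => x + y) ⁻¹' sphere x r = sphere 0 r := by
      ext y
      simp
    have h := ((IsometryEquiv.addLeft x).measurePreserving_hausdorffMeasure
      ((n : ℝ) - 1)).setIntegral_preimage_emb
      (measurableEmbedding_addLeft x) (fun y => u y ^ 2 + v y ^ 2) (sphere x r)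
    simp only [IsometryEquiv.addLeft_apply] at h
    rw [bdry, bdry, ← h, ← hpre]
    rfl
  rw [freq, freq, hb, hs]

end Monotonicity

/-- Almgren monotonicity formula: N(r; x) is nondecreasing in r > 0. -/
theorem almgren_monotonicity {n : ℕ} (hn : 2 ≤ n)
    (u v : EuclideanSpace ℝ (Fin n) → ℝ) (hsol : IsSolution u v)
    (x : EuclideanSpace ℝ (Fin n)) :
    MonotoneOn (fun r : ℝ => freq u v x r) (Set.Ioi 0) := by
  have : NeZero n := ⟨by omega⟩
  suffices h0 : ∀ u v : EuclideanSpace ℝ (Fin n) → ℝ, IsSolution u v →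
      MonotoneOn (fun r : ℝ => freq u v 0 r) (Set.Ioi 0) by
    simpa only [freq_comp_add_left] using h0 _ _ (hsol.comp_add_left x)
  clear hsol u v
  intro u v hsol
  obtain ⟨hu, hv, hpu, hpv, -, -⟩ := id hsol
  obtain ⟨c, hc, hbdry⟩ := exists_setIntegral_sphere_eq_mul_sphInt (E := EuclideanSpace ℝ (Fin n))
  obtain ⟨k, rfl⟩ := Nat.exists_eq_add_of_le' hn
  simp only [finrank_euclideanSpace, Fintype.card_fin] at hbdry
  set σ := (volume : Measure (EuclideanSpace ℝ (Fin (k + 2)))).toSphere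
  have hmass : ContDiff ℝ (⊤ : ℕ∞) fun y => u y ^ 2 + v y ^ 2 := (hu.pow 2).add (hv.pow 2)
  have hmass_pos (y : EuclideanSpace ℝ (Fin (k + 2))) : 0 < u y ^ 2 + v y ^ 2 :=
    add_pos (pow_pos (hpu y) 2) (pow_pos (hpv y) 2)
  have hcr {f : EuclideanSpace ℝ (Fin (k + 2)) → ℝ} (hf : ContDiff ℝ (⊤ : ℕ∞) f) (r : ℝ) :
      Continuous fun ω : sphere (0 : EuclideanSpace ℝ (Fin (k + 2))) 1 =>
        fderiv ℝ f (r • ω.1) ω :=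
    ((hf.continuous_fderiv (by simp)).comp (by fun_prop)).clm_apply continuous_subtype_val
  have hs_pos (r : ℝ) : 0 < sphInt (fun y => u y ^ 2 + v y ^ 2) r := by
    refine (integral_pos_iff_support_of_nonneg (fun ω => (hmass_pos _).le)
      (integrable_sphere (continuous_smul_sphere hmass.continuous r) _)).2 ?_
    have : Function.support (fun ω : sphere (0 : EuclideanSpace ℝ (Fin (k + 2))) 1 =>
        u (r • ω.1) ^ 2 + v (r • ω.1) ^ 2) =
        univ := eq_univ_of_forall fun ω => (hmass_pos _).ne'
    rw [this, Measure.measure_univ_pos]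
    exact Measure.toSphere_ne_zero _
  have hmono := monotoneOn_frequency (k := k) (D := bulk u v 0)
    (P := fun r => ∫ y in ball 0 r, u y ^ 2 * v y ^ 2)
    (h := sphInt fun y => u y ^ 2 + v y ^ 2)
    (e := sphInt fun y => ‖gradient u y‖ ^ 2 + ‖gradient v y‖ ^ 2 + u y ^ 2 * v y ^ 2)
    (q := fun r => ∫ ω : sphere (0 : EuclideanSpace ℝ (Fin (k + 2))) 1,
      fderiv ℝ u (r • ω.1) ω ^ 2 + fderiv ℝ v (r • ω.1) ω ^ 2 ∂σ)
    (m := fun r => ∫ ω : sphere (0 : EuclideanSpace ℝ (Fin (k + 2))) 1,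
      u (r • ω.1) * fderiv ℝ u (r • ω.1) ω +
      v (r • ω.1) * fderiv ℝ v (r • ω.1) ω ∂σ)
    (fun r hr => by
      have hcont : Continuous fun y => ‖gradient u y‖ ^ 2 + ‖gradient v y‖ ^ 2 +
          u y ^ 2 * v y ^ 2 := by
        simpa only [norm_gradient_sq] using (contDiff_energy hu hv).continuous
      have h := hasDerivAt_setIntegral_ball hcont hr
      simp only [finrank_euclideanSpace, Fintype.card_fin] at h
      exact h)
    (fun r _ => by
      convert hasDerivAt_sphInt (hmass.of_le (by simp)) r using 1
      rw [← integral_const_mul]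
      congr 1 with ω
      have hdu := hu.differentiable (by simp) (r • ω.1)
      have hdv := hv.differentiable (by simp) (r • ω.1)
      rw [fderiv_fun_add (hdu.fun_pow 2) (hdv.fun_pow 2), fderiv_fun_pow 2 hdu,
        fderiv_fun_pow 2 hdv]
      simp
      ring)
    (fun r _ => hs_pos r)
    (fun r _ => integral_nonneg fun y => by positivity)
    (fun r _ => integral_nonneg fun y => by positivity)
    (fun r hr => hsol.sphere_normal_eq hr)
    (fun r hr => by simpa [pow_succ] using hsol.pohozaev hr)
    (fun r _ => by
      have hcu := continuous_smul_sphere hu.continuous r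
      have hcv := continuous_smul_sphere hv.continuous r
      exact sq_integral_le_integral_mul_integral
        (integrable_sphere ((hcu.mul (hcr hu r)).add (hcv.mul (hcr hv r))) σ)
        (integrable_sphere ((hcu.pow 2).add (hcv.pow 2)) σ)
        (integrable_sphere (((hcr hu r).pow 2).add ((hcr hv r).pow 2)) σ) (hs_pos r))
  have hfreq : ∀ r ∈ Ioi (0 : ℝ), freq u v 0 r = c⁻¹ * (r * bulk u v 0 r /
      (r ^ (k + 1) * sphInt (fun y => u y ^ 2 + v y ^ 2) r)) := fun r hr => by
    have hb : bdry u v 0 r = c * (r ^ (k + 1) * sphInt (fun y => u y ^ 2 + v y ^ 2) r) :=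
      hbdry _ hmass.continuous hmass_pos r hr
    rw [freq, hb, div_mul_eq_div_div_swap, div_eq_inv_mul]
  intro r hr s hs hrs
  simp only
  rw [hfreq r hr, hfreq s hs]
  exact mul_le_mul_of_nonneg_left (hmono hr hs hrs) (inv_nonneg.2 hc)
end
end
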